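/- (Theorem 5) For p = 3 and any integer q ≥ 7 with gcd(3,q) = 1, one has A(3/q) = (1/q)·(1 + (1 − 2(cos(2πr₀/q) + cos(2π(r₀+1)/q))) / (1 + 2cos(2πr₀/q)cos(2π(r₀+1)/q))), where r₀ = ⌊q/3⌋ is the integer part of q/3. -/

import Mathlib

open Real

/-- Membership in the Turán class `K(h)`, encoded via the nonnegative Fourier cosine
coefficient sequence `a` of a continuous 1-periodic even function
`f(x) = ∑' n, a n * cos (2πnx)`: all `a n ≥ 0`, `∑ a n = 1` (so `f 0 = 1`), and
`f x = 0` for `h ≤ |x| ≤ 1/2`. -/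
def memK (h : ℝ) (a : ℕ → ℝ) : Prop :=
  (∀ n, 0 ≤ a n) ∧ Summable a ∧ (∑' n, a n) = 1 ∧
    ∀ x : ℝ, h ≤ |x| → |x| ≤ 1 / 2 → (∑' n : ℕ, a n * Real.cos (2 * π * n * x)) = 0

/-- The Turán constant `A(h) = sup_{f ∈ K(h)} a₀`. -/
noncomputable def turanA (h : ℝ) : ℝ :=
  sSup {y : ℝ | ∃ a : ℕ → ℝ, memK h a ∧ y = a 0}

/-- The Fourier series of the second Bernoulli polynomial on `[0, 1]`. -/
lemma hasSum_cos_div_sq {x : ℝ} (h0 : 0 ≤ x) (h1 : x ≤ 1) :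
    HasSum (fun n : ℕ => 1 / (n : ℝ) ^ 2 * Real.cos (2 * π * n * x))
      (π ^ 2 * (x ^ 2 - x + 1 / 6)) := by
  have h := hasSum_one_div_nat_pow_mul_cos (k := 1) one_ne_zero (x := x) ⟨h0, h1⟩
  convert h using 1
  simp [Polynomial.bernoulli, Finset.sum_range_succ, bernoulli_one, bernoulli_two]
  ring

/-- The cosine sum over the `q`-th roots of unity `exp (iθj)` is nonnegative. -/
lemma sum_cos_nonneg {q : ℕ} {θ : ℝ} (m : ℤ) (h : q * θ = m * (2 * π)) :
    0 ≤ ∑ j ∈ Finset.range q, Real.cos (j * θ) := by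
  have hre : ∑ j ∈ Finset.range q, Real.cos (j * θ) =
      (∑ j ∈ Finset.range q, Complex.exp (θ * Complex.I) ^ j).re := by
    rw [Complex.re_sum]
    refine Finset.sum_congr rfl fun j _ => ?_
    rw [← Complex.exp_nat_mul, ← mul_assoc]
    have := Complex.exp_ofReal_mul_I_re (j * θ)
    push_cast at this
    exact this.symm
  rw [hre]
  by_cases h1 : Complex.exp (θ * Complex.I) = 1
  · simp [h1]
  · rw [geom_sum_eq h1, ← Complex.exp_nat_mul, ← mul_assoc]
    have : (q : ℂ) * θ = m * (2 * π) := by exact_mod_cast h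
    rw [this, mul_assoc, Complex.exp_int_mul_two_pi_mul_I]
    simp

/-- Discrete orthogonality of cosines, as an inequality. -/
lemma sum_cos_mul_cos_nonneg {q : ℕ} (hq : q ≠ 0) (n k : ℕ) :
    0 ≤ ∑ j ∈ Finset.range q,
      Real.cos (2 * π * n * (j / q)) * Real.cos (2 * π * k * (j / q)) := by
  have hq' : (q : ℝ) ≠ 0 := by exact_mod_cast hq
  have h1 := sum_cos_nonneg (q := q) (θ := 2 * π * (n + k) / q) ((n + k : ℕ) : ℤ)
    (by push_cast; field_simp)
  have h2 := sum_cos_nonneg (q := q) (θ := 2 * π * (n - k) / q) ((n : ℤ) - k)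
    (by push_cast; field_simp)
  have h3 : ∑ j ∈ Finset.range q,
      Real.cos (2 * π * n * (j / q)) * Real.cos (2 * π * k * (j / q)) =
      (∑ j ∈ Finset.range q, Real.cos (j * (2 * π * (n + k) / q)) +
        ∑ j ∈ Finset.range q, Real.cos (j * (2 * π * (n - k) / q))) / 2 := by
    rw [← Finset.sum_add_distrib, Finset.sum_div]
    refine Finset.sum_congr rfl fun j _ => ?_
    rw [show (j : ℝ) * (2 * π * (n + k) / q) = 2 * π * n * (j / q) + 2 * π * k * (j / q) by ring,
      show (j : ℝ) * (2 * π * (n - k) / q) = 2 * π * n * (j / q) - 2 * π * k * (j / q) by ring,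
      Real.cos_add, Real.cos_sub]
    ring
  rw [h3]
  positivity

lemma memK.summable_mul_cos {h : ℝ} {a : ℕ → ℝ} (ha : memK h a) (x : ℝ) :
    Summable fun n : ℕ => a n * Real.cos (2 * π * n * x) := by
  refine Summable.of_norm_bounded ha.2.1 fun n => ?_
  rw [norm_mul, Real.norm_of_nonneg (ha.1 n)]
  exact mul_le_of_le_one_right (ha.1 n) (Real.abs_cos_le_one _)

lemma cos_nat_mul_one_sub (n : ℕ) (x : ℝ) :
    Real.cos (2 * π * n * (1 - x)) = Real.cos (2 * π * n * x) := by
  rw [show 2 * π * n * (1 - x) = n * (2 * π) - 2 * π * n * x by ring,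
    Real.cos_nat_mul_two_pi_sub]

/-- For `f ∈ K(3/q)` the values of `f` on `ℤ/q` have the form `(1, X, Y, 0, …, 0, Y, X)`. -/
lemma memK.sum_sample {q : ℕ} (hq : 7 ≤ q) {a : ℕ → ℝ} (ha : memK (3 / q) a) (k : ℕ) :
    ∑ j ∈ Finset.range q,
      (∑' n : ℕ, a n * Real.cos (2 * π * n * (j / q))) * Real.cos (2 * π * k * (j / q)) =
    1 + 2 * (∑' n : ℕ, a n * Real.cos (2 * π * n * (1 / q))) * Real.cos (2 * π * k / q) +
      2 * (∑' n : ℕ, a n * Real.cos (2 * π * n * (2 / q))) *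
        (2 * Real.cos (2 * π * k / q) ^ 2 - 1) := by
  have hq0 : (0 : ℝ) < q := by exact_mod_cast (by omega : 0 < q)
  have hsub : ({0, 1, 2, q - 2, q - 1} : Finset ℕ) ⊆ Finset.range q := by
    intro j
    simp only [Finset.mem_insert, Finset.mem_singleton, Finset.mem_range]
    omega
  have hrefl (x : ℝ) : (∑' n : ℕ, a n * Real.cos (2 * π * n * (1 - x))) =
      ∑' n : ℕ, a n * Real.cos (2 * π * n * x) := by
    simp only [cos_nat_mul_one_sub]
  rw [← Finset.sum_subset hsub]
  · rw [Finset.sum_insert, Finset.sum_insert, Finset.sum_insert, Finset.sum_insert,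
      Finset.sum_singleton]
    · have e2 : ((q - 2 : ℕ) : ℝ) / q = 1 - 2 / q := by
        rw [Nat.cast_sub (by omega)]; field_simp; simp
      have e1 : ((q - 1 : ℕ) : ℝ) / q = 1 - 1 / q := by
        rw [Nat.cast_sub (by omega)]; field_simp; simp
      rw [e1, e2, hrefl, hrefl, cos_nat_mul_one_sub, cos_nat_mul_one_sub,
        ← Real.cos_two_mul, show 2 * (2 * π * k / q) = 2 * π * k * (2 / q) by ring,
        show 2 * π * k / q = 2 * π * k * (1 / q) by ring]
      simp [ha.2.2.1]
      ring
    all_goals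
      simp only [Finset.mem_insert, Finset.mem_singleton]
      omega
  · intro j hj hj'
    simp only [Finset.mem_insert, Finset.mem_singleton, Finset.mem_range] at hj hj'
    have h3 : 3 ≤ j := by omega
    have h3' : j + 3 ≤ q := by omega
    have h3r : (3 : ℝ) ≤ j := by exact_mod_cast h3
    have h3r' : (j : ℝ) + 3 ≤ q := by exact_mod_cast h3'
    have hz : (∑' n : ℕ, a n * Real.cos (2 * π * n * (j / q))) = 0 := by
      rcases le_total ((j : ℝ) / q) (1 / 2) with h | h
      · apply ha.2.2.2
        · rw [abs_of_nonneg (by positivity)]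
          gcongr
        · rwa [abs_of_nonneg (by positivity)]
      · have hj1 : 3 / (q : ℝ) ≤ 1 - j / q := by
          rw [div_le_iff₀ hq0, sub_mul, div_mul_cancel₀ _ hq0.ne']
          linarith
        have hpos : (0 : ℝ) ≤ 1 - j / q := le_trans (by positivity) hj1
        rw [← hrefl]
        apply ha.2.2.2
        · rwa [abs_of_nonneg hpos]
        · rw [abs_of_nonneg hpos]
          linarith
    rw [hz, zero_mul]

lemma memK.hasSum_sample {q : ℕ} {h : ℝ} {a : ℕ → ℝ} (ha : memK h a) (k : ℕ) :
    HasSum (fun n => a n * ∑ j ∈ Finset.range q,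
        Real.cos (2 * π * n * (j / q)) * Real.cos (2 * π * k * (j / q)))
      (∑ j ∈ Finset.range q,
      (∑' n : ℕ, a n * Real.cos (2 * π * n * (j / q))) * Real.cos (2 * π * k * (j / q))) := by
  have := hasSum_sum (s := Finset.range q) fun j _ =>
    ((ha.summable_mul_cos (j / q)).hasSum.mul_right (Real.cos (2 * π * k * (j / q))))
  simpa only [Finset.mul_sum, mul_assoc] using this

/-- The cosine of a multiple of `2π/q` avoids the open interval between consecutive nodes. -/
lemma cos_sub_mul_cos_sub_nonneg {q r : ℕ} (hr : 2 * (r + 1) ≤ q) (n : ℕ) :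
    0 ≤ (Real.cos (2 * π * n / q) - Real.cos (2 * π * r / q)) *
      (Real.cos (2 * π * n / q) - Real.cos (2 * π * (r + 1) / q)) := by
  have hq : 0 < q := by omega
  have hq0 : (0 : ℝ) < q := by exact_mod_cast hq
  obtain ⟨m, hm, hcos⟩ : ∃ m : ℕ, 2 * m ≤ q ∧
      Real.cos (2 * π * n / q) = Real.cos (2 * π * m / q) := by
    have hmod : Real.cos (2 * π * n / q) = Real.cos (2 * π * (n % q : ℕ) / q) := by
      have : (n : ℝ) = (n % q : ℕ) + q * (n / q : ℕ) := by exact_mod_cast (Nat.mod_add_div n q).symm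
      rw [show 2 * π * n / q = 2 * π * (n % q : ℕ) / q + (n / q : ℕ) * (2 * π) by
        rw [this]; field_simp, Real.cos_add_nat_mul_two_pi]
    have hlt := Nat.mod_lt n hq
    rcases le_total (2 * (n % q)) q with h | h
    · exact ⟨_, h, hmod⟩
    · refine ⟨q - n % q, by omega, ?_⟩
      rw [hmod, Nat.cast_sub hlt.le, show 2 * π * ((q : ℝ) - (n % q : ℕ)) / q =
        2 * π - 2 * π * (n % q : ℕ) / q by field_simp, Real.cos_two_pi_sub]
  have anti {i j : ℕ} (hij : i ≤ j) (hj : 2 * j ≤ q) :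
      Real.cos (2 * π * j / q) ≤ Real.cos (2 * π * i / q) := by
    have hj' : (2 : ℝ) * j ≤ q := by exact_mod_cast hj
    apply Real.cos_le_cos_of_nonneg_of_le_pi
    · positivity
    · rw [div_le_iff₀ hq0]
      nlinarith [Real.pi_pos]
    · gcongr
  have hcast : (r : ℝ) + 1 = (r + 1 : ℕ) := by push_cast; rfl
  rw [hcos, hcast]
  have hrr := anti (Nat.le_succ r) hr
  rcases Nat.lt_or_ge r m with h | h
  · have := anti h hm
    exact mul_nonneg_of_nonpos_of_nonpos (by linarith) (by linarith)
  · have := anti h (by omega)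
    exact mul_nonneg (by linarith) (by linarith)

/-- Fourier coefficients of the piecewise linear function with nodes in `ℤ/q` and nodal values
`1, X, Y` at `0, ±1/q, ±2/q`. -/
noncomputable def linearCoeff (q : ℕ) (X Y : ℝ) (n : ℕ) : ℝ :=
  Pi.single (M := fun _ => ℝ) 0 (1 / q * (1 + 2 * X + 2 * Y)) n +
    q / π ^ 2 * (1 / (n : ℝ) ^ 2 * ((1 - Real.cos (2 * π * n / q)) *
      (1 + 2 * X * Real.cos (2 * π * n / q) + 2 * Y * (2 * Real.cos (2 * π * n / q) ^ 2 - 1))))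

lemma linearCoeff_zero (q : ℕ) (X Y : ℝ) :
    linearCoeff q X Y 0 = 1 / q * (1 + 2 * X + 2 * Y) := by
  simp [linearCoeff]

lemma linearCoeff_mul_cos (q : ℕ) (X Y : ℝ) (n : ℕ) (x : ℝ) :
    linearCoeff q X Y n * Real.cos (2 * π * n * x) =
    Pi.single (M := fun _ => ℝ) 0 (1 / q * (1 + 2 * X + 2 * Y)) n + q / π ^ 2 * (
      (1 - X) * (1 / (n : ℝ) ^ 2 * Real.cos (2 * π * n * x)) +
      (X - 1 / 2 - Y / 2) * (1 / (n : ℝ) ^ 2 * Real.cos (2 * π * n * (x + 1 / q)) +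
        1 / (n : ℝ) ^ 2 * Real.cos (2 * π * n * (x - 1 / q))) +
      (Y - X / 2) * (1 / (n : ℝ) ^ 2 * Real.cos (2 * π * n * (x + 2 / q)) +
        1 / (n : ℝ) ^ 2 * Real.cos (2 * π * n * (x - 2 / q))) +
      (- Y / 2) * (1 / (n : ℝ) ^ 2 * Real.cos (2 * π * n * (x + 3 / q)) +
        1 / (n : ℝ) ^ 2 * Real.cos (2 * π * n * (x - 3 / q)))) := by
  have hs : Pi.single (M := fun _ => ℝ) 0 (1 / q * (1 + 2 * X + 2 * Y)) n *
      Real.cos (2 * π * n * x) = Pi.single (M := fun _ => ℝ) 0 (1 / q * (1 + 2 * X + 2 * Y)) n := by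
    rcases eq_or_ne n 0 with rfl | hn
    · simp
    · simp [hn]
  have hsum (y : ℝ) : Real.cos (2 * π * n * (x + y)) + Real.cos (2 * π * n * (x - y)) =
      2 * Real.cos (2 * π * n * x) * Real.cos (2 * π * n * y) := by
    rw [mul_add, mul_sub, Real.cos_add, Real.cos_sub]
    ring
  simp only [← mul_add, hsum]
  rw [linearCoeff, add_mul, hs,
    show 2 * π * n * (1 / q) = 2 * π * n / q by ring,
    show 2 * π * n * (2 / q) = 2 * (2 * π * n / q) by ring,
    show 2 * π * n * (3 / q) = 3 * (2 * π * n / q) by ring,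
    Real.cos_two_mul, Real.cos_three_mul]
  ring

lemma hasSum_linearCoeff_mul_cos {q : ℕ} (hq : 7 ≤ q) (X Y : ℝ) {x : ℝ}
    (h0 : 3 / q ≤ x) (h1 : x ≤ 1 / 2) :
    HasSum (fun n : ℕ => linearCoeff q X Y n * Real.cos (2 * π * n * x)) 0 := by
  have hq7 : (7 : ℝ) ≤ q := by exact_mod_cast hq
  have hq0 : (0 : ℝ) < q := by linarith
  have h3 : 3 / (q : ℝ) ≤ 3 / 7 := by gcongr
  have h2 : 2 / (q : ℝ) ≤ 3 / q := by gcongr; norm_num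
  have h1' : 1 / (q : ℝ) ≤ 2 / q := by gcongr; norm_num
  have hp : 0 < 1 / (q : ℝ) := by positivity
  have B {y : ℝ} (hy : 0 ≤ y) (hy1 : y ≤ 1) := hasSum_cos_div_sq hy hy1
  have key := (hasSum_pi_single 0 (1 / q * (1 + 2 * X + 2 * Y))).add
    ((((((B (y := x) (by linarith) (by linarith)).mul_left (1 - X)).add
    (((B (y := x + 1 / q) (by linarith) (by linarith)).add
      (B (y := x - 1 / q) (by linarith) (by linarith))).mul_left (X - 1 / 2 - Y / 2))).add
    (((B (y := x + 2 / q) (by linarith) (by linarith)).add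
      (B (y := x - 2 / q) (by linarith) (by linarith))).mul_left (Y - X / 2))).add
    (((B (y := x + 3 / q) (by linarith) (by linarith)).add
      (B (y := x - 3 / q) (by linarith) (by linarith))).mul_left (-Y / 2))).mul_left (q / π ^ 2))
  simp only [linearCoeff_mul_cos]
  convert key using 1
  have := Real.pi_ne_zero
  field_simp
  ring

lemma hasSum_linearCoeff {q : ℕ} (hq : 7 ≤ q) (X Y : ℝ) :
    HasSum (linearCoeff q X Y) 1 := by
  have hq7 : (7 : ℝ) ≤ q := by exact_mod_cast hq
  have hq0 : (0 : ℝ) < q := by linarith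
  have B {y : ℝ} (hy : 0 ≤ y) (hy1 : y ≤ 7) :
      HasSum (fun n : ℕ => 1 / (n : ℝ) ^ 2 * Real.cos (2 * π * n * (y / q)))
        (π ^ 2 * ((y / q) ^ 2 - y / q + 1 / 6)) :=
    hasSum_cos_div_sq (by positivity) ((div_le_one hq0).2 (by linarith))
  have B' {y : ℝ} (hy : 0 ≤ y) (hy1 : y ≤ 7) :
      HasSum (fun n : ℕ => 1 / (n : ℝ) ^ 2 * Real.cos (2 * π * n * (0 + y / q)) +
        1 / (n : ℝ) ^ 2 * Real.cos (2 * π * n * (0 - y / q)))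
        (2 * (π ^ 2 * ((y / q) ^ 2 - y / q + 1 / 6))) := by
    simpa [two_mul] using (B hy hy1).add (B hy hy1)
  have key := (hasSum_pi_single 0 (1 / q * (1 + 2 * X + 2 * Y))).add
    ((((((hasSum_cos_div_sq le_rfl zero_le_one).mul_left (1 - X)).add
    ((B' (y := 1) (by norm_num) (by norm_num)).mul_left (X - 1 / 2 - Y / 2))).add
    ((B' (y := 2) (by norm_num) (by norm_num)).mul_left (Y - X / 2))).add
    ((B' (y := 3) (by norm_num) (by norm_num)).mul_left (-Y / 2))).mul_left (q / π ^ 2))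
  simp only [← linearCoeff_mul_cos] at key
  simp only [mul_zero, Real.cos_zero, mul_one] at key
  convert key using 1
  have := Real.pi_ne_zero
  field_simp
  ring

lemma memK_linearCoeff {q : ℕ} (hq : 7 ≤ q) {X Y : ℝ}
    (hXY : ∀ n : ℕ, 0 ≤ 1 + 2 * X * Real.cos (2 * π * n / q) +
      2 * Y * (2 * Real.cos (2 * π * n / q) ^ 2 - 1)) :
    memK (3 / q) (linearCoeff q X Y) := by
  refine ⟨fun n => ?_, (hasSum_linearCoeff hq X Y).summable, (hasSum_linearCoeff hq X Y).tsum_eq,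
    fun x h0 h1 => ?_⟩
  · rcases eq_or_ne n 0 with rfl | hn
    · have h := hXY 0
      norm_num at h
      rw [linearCoeff_zero]
      positivity
    · have hc : 0 ≤ 1 - Real.cos (2 * π * n / q) := sub_nonneg.2 (Real.cos_le_one _)
      have h := hXY n
      simp only [linearCoeff, Pi.single_eq_of_ne hn, zero_add]
      positivity
  · have habs (n : ℕ) : Real.cos (2 * π * n * x) = Real.cos (2 * π * n * |x|) := by
      rw [← Real.cos_abs, abs_mul, abs_of_nonneg (by positivity : 0 ≤ 2 * π * (n : ℝ))]
    simp only [habs]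
    exact (hasSum_linearCoeff_mul_cos hq X Y h0 h1).tsum_eq

/-- Theorem 5: for `p = 3` and any integer `q ≥ 7` coprime to `3`, with `r₀ = ⌊q/3⌋`,
`A(3/q) = (1/q) (1 + (1 - 2(cos (2πr₀/q) + cos (2π(r₀+1)/q))) /
(1 + 2 cos (2πr₀/q) cos (2π(r₀+1)/q)))`. -/
theorem turanA_three_div (q : ℕ) (hq : 7 ≤ q) (hco : Nat.Coprime 3 q)
    (r₀ : ℕ) (hr₀ : r₀ = q / 3) :
    turanA (3 / q) = (1 / q) *
      (1 + (1 - 2 * (Real.cos (2 * π * r₀ / q) + Real.cos (2 * π * (r₀ + 1) / q))) /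
        (1 + 2 * Real.cos (2 * π * r₀ / q) * Real.cos (2 * π * (r₀ + 1) / q))) := by
  have hmod : ¬ 3 ∣ q := (Nat.Prime.coprime_iff_not_dvd Nat.prime_three).1 hco
  have hq0 : (0 : ℝ) < q := by exact_mod_cast (by omega : 0 < q)
  have hpi := Real.pi_pos
  have hquarter : (q : ℝ) ≤ 4 * r₀ := by exact_mod_cast (by omega : q ≤ 4 * r₀)
  have hthird : (3 : ℝ) * r₀ < q := by exact_mod_cast (by omega : 3 * r₀ < q)
  have hthird' : (q : ℝ) < 3 * (r₀ + 1) := by exact_mod_cast (by omega : q < 3 * (r₀ + 1))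
  have hhalf : (2 : ℝ) * (r₀ + 1) ≤ q := by exact_mod_cast (by omega : 2 * (r₀ + 1) ≤ q)
  have hcos : Real.cos (2 * π / 3) = -1 / 2 := by
    rw [show 2 * π / 3 = π - π / 3 by ring, Real.cos_pi_sub, Real.cos_pi_div_three]
    norm_num
  have hc1 : -1 / 2 < Real.cos (2 * π * r₀ / q) := by
    rw [← hcos]
    apply Real.cos_lt_cos_of_nonneg_of_le_pi
    · positivity
    · linarith
    · rw [div_lt_div_iff₀ hq0 (by norm_num)]
      nlinarith
  have hc1' : Real.cos (2 * π * r₀ / q) ≤ 0 := by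
    apply Real.cos_nonpos_of_pi_div_two_le_of_le
    · rw [div_le_div_iff₀ (by norm_num) hq0]
      nlinarith
    · rw [div_le_iff₀ hq0]
      nlinarith
  have hc2 : Real.cos (2 * π * (r₀ + 1) / q) < -1 / 2 := by
    rw [← hcos]
    apply Real.cos_lt_cos_of_nonneg_of_le_pi
    · positivity
    · rw [div_le_iff₀ hq0]
      nlinarith
    · rw [div_lt_div_iff₀ (by norm_num) hq0]
      nlinarith
  have hnode := cos_sub_mul_cos_sub_nonneg (q := q) (r := r₀) (by omega)
  have hcast : 2 * π * ((r₀ + 1 : ℕ) : ℝ) / q = 2 * π * (r₀ + 1) / q := by push_cast; rfl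
  generalize hc1d : Real.cos (2 * π * r₀ / q) = c₁ at *
  generalize hc2d : Real.cos (2 * π * (r₀ + 1) / q) = c₂ at *
  have hD : 0 < 1 + 2 * c₁ * c₂ := by nlinarith
  refine IsGreatest.csSup_eq ⟨?_, ?_⟩
  · refine ⟨linearCoeff q (-(c₁ + c₂) / (1 + 2 * c₁ * c₂)) (1 / (2 * (1 + 2 * c₁ * c₂))),
      memK_linearCoeff hq fun n => ?_, ?_⟩
    · have := hnode n
      rw [show ∀ c : ℝ, 1 + 2 * (-(c₁ + c₂) / (1 + 2 * c₁ * c₂)) * c +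
        2 * (1 / (2 * (1 + 2 * c₁ * c₂))) * (2 * c ^ 2 - 1) =
        2 * ((c - c₁) * (c - c₂)) / (1 + 2 * c₁ * c₂) by intro c; field_simp; ring]
      positivity
    · rw [linearCoeff_zero]
      field_simp
      ring
  · rintro _ ⟨a, ha, rfl⟩
    have hnonneg (k : ℕ) := (ha.hasSum_sample (q := q) k).nonneg fun n =>
      mul_nonneg (ha.1 n) (sum_cos_mul_cos_nonneg (by omega : q ≠ 0) n k)
    have hG1 := hnonneg r₀
    have hG2 := hnonneg (r₀ + 1)
    have hG0 := le_hasSum (ha.hasSum_sample (q := q) 0) 0 fun n _ =>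
      mul_nonneg (ha.1 n) (sum_cos_mul_cos_nonneg (by omega : q ≠ 0) n 0)
    rw [ha.sum_sample hq] at hG0 hG1 hG2
    rw [hc1d] at hG1
    rw [hcast, hc2d] at hG2
    norm_num at hG0
    simp only [← one_div] at hG0
    generalize (∑' n : ℕ, a n * Real.cos (2 * π * n * (1 / q))) = X at *
    generalize (∑' n : ℕ, a n * Real.cos (2 * π * n * (2 / q))) = Y at *
    have hV : 2 * X + 2 * Y ≤ (1 - 2 * (c₁ + c₂)) / (1 + 2 * c₁ * c₂) := by
      rw [le_div_iff₀ hD]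
      have m1 := mul_nonneg hG1 (mul_nonneg (by linarith : 0 ≤ 1 - c₂)
        (by linarith : 0 ≤ -(1 + 2 * c₂)))
      have m2 := mul_nonneg hG2 (mul_nonneg (by linarith : 0 ≤ 1 - c₁)
        (by linarith : 0 ≤ 1 + 2 * c₁))
      have hpos : 0 < c₁ - c₂ := by linarith
      refine le_of_mul_le_mul_left ?_ hpos
      linarith
    rw [one_div, ← div_eq_inv_mul, le_div_iff₀ hq0]
    linarith
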